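/- Let T > 0, α ∈ (1,2), β := α/2, let u : [0,T] → ℝ be twice continuously differentiable, and set ũ(t) := u(t) − t·u′(0). Then for every t ∈ (0,T], D^α u(t) = D^α ũ(t) = D^β(D^β ũ)(t), where D^β g(t) := (1/Γ(1−β)) ∫_0^t (t−s)^{−β} g′(s) ds denotes the Caputo derivative of order β ∈ (0,1), D^α v(t) := (1/Γ(2−α)) ∫_0^t (t−s)^{1−α} v″(s) ds denotes the Caputo derivative of order α ∈ (1,2), and the outer D^β is applied to the function t ↦ D^β ũ(t). -/

import Mathlib

/-- The Caputo fractional derivative of order `β ∈ (0,1)` of a function `g` on `[0,T]`: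
`D^β g(t) = (1/Γ(1−β)) ∫_0^t (t−s)^{−β} g'(s) ds`. -/
noncomputable def caputoLow (T β : ℝ) (g : ℝ → ℝ) (t : ℝ) : ℝ :=
  (Real.Gamma (1 - β))⁻¹ *
    ∫ s in (0 : ℝ)..t, (t - s) ^ (-β) * derivWithin g (Set.Icc (0 : ℝ) T) s

/-- The Caputo fractional derivative of order `α ∈ (1,2)` of a function `v` on `[0,T]`:
`D^α v(t) = (1/Γ(2−α)) ∫_0^t (t−s)^{1−α} v''(s) ds`. -/
noncomputable def caputoHigh (T α : ℝ) (v : ℝ → ℝ) (t : ℝ) : ℝ :=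
  (Real.Gamma (2 - α))⁻¹ *
    ∫ s in (0 : ℝ)..t, (t - s) ^ (1 - α) *
      derivWithin (derivWithin v (Set.Icc (0 : ℝ) T)) (Set.Icc (0 : ℝ) T) s

open MeasureTheory Set Filter

lemma integral_rpow_mul_sub_rpow {a b x : ℝ} (ha : 0 < a) (hb : 0 < b) (hx : 0 < x) :
    ∫ s in (0 : ℝ)..x, s ^ (a - 1) * (x - s) ^ (b - 1) =
      ProbabilityTheory.beta a b * x ^ (a + b - 1) := by
  have hbeta : Complex.betaIntegral a b = (ProbabilityTheory.beta a b : ℂ) := by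
    rw [Complex.betaIntegral_eq_Gamma_mul_div _ _ (by simpa) (by simpa), ProbabilityTheory.beta]
    push_cast [Complex.Gamma_ofReal]
    rw [← Complex.Gamma_ofReal (a + b)]
    push_cast
    rfl
  have h := Complex.betaIntegral_scaled (a : ℂ) (b : ℂ) hx
  rw [hbeta] at h
  apply Complex.ofReal_injective
  rw [← intervalIntegral.integral_ofReal]
  push_cast
  rw [Complex.ofReal_cpow hx.le, mul_comm]
  push_cast
  rw [← h]
  refine intervalIntegral.integral_congr fun s hs => ?_
  rw [uIcc_of_le hx.le] at hs
  rw [Complex.ofReal_cpow hs.1, Complex.ofReal_cpow (sub_nonneg.2 hs.2)]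
  push_cast
  rfl

/-- The Riemann–Liouville integral of order `a`, without its factor `1 / Γ(a)`. -/
noncomputable def rlIntegral (a : ℝ) (f : ℝ → ℝ) (x : ℝ) : ℝ :=
  ∫ s in (0 : ℝ)..x, (x - s) ^ (a - 1) * f s

/-- The kernel of `rlIntegral a`. -/
noncomputable def rlKernel (a : ℝ) : ℝ → ℝ := indicator (Ioi 0) fun x => x ^ (a - 1)

lemma rlIntegral_congr {a x : ℝ} {f g : ℝ → ℝ} (hx : 0 ≤ x) (h : ∀ s ∈ Ioc 0 x, f s = g s) :
    rlIntegral a f x = rlIntegral a g x := by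
  refine intervalIntegral.integral_congr_ae (ae_of_all _ fun s hs => ?_)
  rw [uIoc_of_le hx] at hs
  rw [h s hs]

lemma rlIntegral_const_mul (a c : ℝ) (f : ℝ → ℝ) (x : ℝ) :
    rlIntegral a (fun s => c * f s) x = c * rlIntegral a f x := by
  simp only [rlIntegral, ← intervalIntegral.integral_const_mul, mul_left_comm]

lemma rlIntegral_one (f : ℝ → ℝ) (x : ℝ) : rlIntegral 1 f x = ∫ s in (0 : ℝ)..x, f s := by
  simp [rlIntegral]

lemma rlKernel_nonneg (a x : ℝ) : 0 ≤ rlKernel a x :=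
  indicator_nonneg (fun _ hy => Real.rpow_nonneg (le_of_lt hy) _) x

lemma measurable_rlKernel (a : ℝ) : Measurable (rlKernel a) :=
  Measurable.indicator (by fun_prop) measurableSet_Ioi

open ContinuousLinearMap in
lemma convolution_rlKernel (a : ℝ) (f : ℝ → ℝ) :
    convolution (rlKernel a) (indicator (Ioi 0) f) (mul ℝ ℝ) volume =
      indicator (Ioi 0) (rlIntegral a f) := by
  rw [rlKernel, ← posConvolution_eq_convolution_indicator _ _ _ volume, posConvolution]
  congr 1
  funext x
  rw [rlIntegral]
  simpa using intervalIntegral.integral_comp_sub_left (a := 0) (b := x)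
    (fun s => (x - s) ^ (a - 1) * f s) x

open ContinuousLinearMap in
lemma convolution_rlKernel_rlKernel {a b : ℝ} (ha : 0 < a) (hb : 0 < b) :
    convolution (rlKernel a) (rlKernel b) (mul ℝ ℝ) volume =
      ProbabilityTheory.beta a b • rlKernel (a + b) := by
  rw [rlKernel, rlKernel, ← posConvolution_eq_convolution_indicator _ _ _ volume, posConvolution, rlKernel]
  funext x
  rcases le_or_gt x 0 with hx | hx
  · simp [hx]
  · simpa [hx] using integral_rpow_mul_sub_rpow ha hb hx

lemma intervalIntegrable_sub_rpow {a : ℝ} (ha : 0 < a) (x : ℝ) :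
    IntervalIntegrable (fun s => (x - s) ^ (a - 1)) volume 0 x := by
  have h := (intervalIntegral.intervalIntegrable_rpow' (r := a - 1) (by linarith) (a := 0)
    (b := x)).comp_sub_left x
  simpa using h.symm

/-- A continuous function on `ℝ` that agrees with `rlIntegral a f` on `[0, ∞)`. -/
lemma exists_continuous_eqOn_rlIntegral {a C : ℝ} (ha : 0 < a) {f : ℝ → ℝ} (hf : Continuous f)
    (hC : ∀ x, |f x| ≤ C) :
    ∃ g : ℝ → ℝ, Continuous g ∧ EqOn (rlIntegral a f) g (Ici 0) := by
  refine ⟨fun x => x ^ a * ∫ r in (0 : ℝ)..1, (1 - r) ^ (a - 1) * f (x * r),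
    (Real.continuous_rpow_const ha.le).mul ?_, fun x hx => ?_⟩
  · refine intervalIntegral.continuous_of_dominated_interval
      (bound := fun r => (1 - r) ^ (a - 1) * C) (fun x => ?_) (fun x => ?_) ?_ ?_
    · exact (Measurable.mul (by fun_prop) (by fun_prop)).aestronglyMeasurable
    · refine ae_of_all _ fun r hr => ?_
      rw [uIoc_of_le zero_le_one] at hr
      rw [Real.norm_eq_abs, abs_mul, abs_of_nonneg (Real.rpow_nonneg (sub_nonneg.2 hr.2) _)]
      exact mul_le_mul_of_nonneg_left (hC _) (Real.rpow_nonneg (sub_nonneg.2 hr.2) _)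
    · exact (intervalIntegrable_sub_rpow ha 1).mul_const C
    · exact ae_of_all _ fun r _ => by fun_prop
  · rcases eq_or_lt_of_le (mem_Ici.1 hx) with rfl | hx
    · simp [rlIntegral, Real.zero_rpow ha.ne']
    · have h := intervalIntegral.mul_integral_comp_mul_left (a := 0) (b := 1)
        (f := fun s => (x - s) ^ (a - 1) * f s) x
      simp only [mul_zero, mul_one] at h
      beta_reduce
      rw [rlIntegral, ← h, ← intervalIntegral.integral_const_mul,
        ← intervalIntegral.integral_const_mul]
      refine intervalIntegral.integral_congr fun r hr => ?_
      rw [uIcc_of_le zero_le_one] at hr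
      rw [show x - x * r = x * (1 - r) by ring, Real.mul_rpow hx.le (sub_nonneg.2 hr.2),
        Real.rpow_sub_one hx.ne']
      field_simp

open ContinuousLinearMap in
lemma convolutionExistsAt_rlKernel {a : ℝ} (ha : 0 < a) {f : ℝ → ℝ} (hf : Continuous f) (x : ℝ) :
    ConvolutionExistsAt (rlKernel a) (indicator (Ioi 0) f) x (mul ℝ ℝ) volume := by
  rw [← convolutionExistsAt_flip, ConvolutionExistsAt]
  rcases le_or_gt x 0 with hx | hx
  · refine (integrable_zero ℝ ℝ volume).congr (ae_of_all _ fun s => ?_)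
    rcases le_or_gt s 0 with hs | hs
    · simp [hs]
    · simp [rlKernel, show x ≤ s by linarith]
  · have h := ((intervalIntegrable_sub_rpow ha x).mul_continuousOn hf.continuousOn)
    rw [intervalIntegrable_iff_integrableOn_Ioo_of_le hx.le,
      ← integrable_indicator_iff measurableSet_Ioo] at h
    refine h.congr (ae_of_all _ fun s => ?_)
    by_cases h1 : 0 < s <;> by_cases h2 : s < x <;> simp [rlKernel, indicator, h1, h2, mul_comm]

open ContinuousLinearMap in
lemma convolutionExistsAt_rlKernel_rlKernel {a b : ℝ} (ha : 0 < a) (hb : 0 < b) (x : ℝ) :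
    ConvolutionExistsAt (rlKernel a) (rlKernel b) x (mul ℝ ℝ) volume := by
  rcases le_or_gt x 0 with hx | hx
  · refine (integrable_zero ℝ ℝ volume).congr (ae_of_all _ fun s => ?_)
    rcases le_or_gt s 0 with hs | hs
    · simp [rlKernel, hs]
    · simp [rlKernel, show x ≤ s by linarith]
  · by_contra h
    have h0 := congrFun (convolution_rlKernel_rlKernel ha hb) x
    rw [convolution, integral_undef h] at h0
    have hbeta := (ProbabilityTheory.beta_pos ha hb).ne'
    have hpow := (Real.rpow_pos_of_pos hx (a + b - 1)).ne'
    simp [rlKernel, hx, hbeta, hpow] at h0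

open ContinuousLinearMap in
/-- The semigroup property of Riemann–Liouville integrals. -/
lemma rlIntegral_rlIntegral {a b C x : ℝ} (ha : 0 < a) (hb : 0 < b) {f : ℝ → ℝ}
    (hf : Continuous f) (hC : ∀ x, |f x| ≤ C) (hx : 0 ≤ x) :
    rlIntegral a (rlIntegral b f) x = ProbabilityTheory.beta a b * rlIntegral (a + b) f x := by
  rcases hx.eq_or_lt with rfl | hx
  · simp [rlIntegral]
  have hnorm (c : ℝ) : (fun y => ‖rlKernel c y‖) = rlKernel c :=
    funext fun y => by rw [Real.norm_eq_abs, abs_of_nonneg (rlKernel_nonneg c y)]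
  have hnormf : (fun y => ‖indicator (Ioi 0) f y‖) = indicator (Ioi 0) fun y => |f y| :=
    funext fun y => norm_indicator_eq_indicator_norm f y
  obtain ⟨g, hg, hgeq⟩ := exists_continuous_eqOn_rlIntegral (C := C) hb hf.abs (by simpa using hC)
  have key := convolution_assoc (mul ℝ ℝ) (mul ℝ ℝ) (mul ℝ ℝ) (mul ℝ ℝ) (x₀ := x)
    (f := rlKernel a) (g := rlKernel b) (k := indicator (Ioi 0) f) (μ := volume) (ν := volume)
    (fun p q r => mul_assoc p q r)
    (measurable_rlKernel a).aestronglyMeasurable (measurable_rlKernel b).aestronglyMeasurable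
    (hf.measurable.indicator measurableSet_Ioi).aestronglyMeasurable
    ?_ ?_ ?_
  · rw [convolution_rlKernel, convolution_rlKernel, convolution_rlKernel_rlKernel ha hb,
      smul_convolution, convolution_rlKernel] at key
    simpa [hx] using key.symm
  · exact ae_of_all _ fun y => convolutionExistsAt_rlKernel_rlKernel ha hb y
  · rw [hnorm, hnormf]
    exact ae_of_all _ fun y => convolutionExistsAt_rlKernel hb hf.abs y
  · rw [hnorm, hnorm, hnormf, convolution_rlKernel,
      indicator_congr (s := Ioi 0) (g := g) fun y hy => hgeq (le_of_lt (mem_Ioi.1 hy))]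
    exact convolutionExistsAt_rlKernel ha hg x

lemma ContDiffOn.exists_continuous_bounded_eqOn_derivWithin {u : ℝ → ℝ} {T : ℝ} (hT : 0 < T)
    (hu : ContDiffOn ℝ 2 u (Icc 0 T)) :
    ∃ f : ℝ → ℝ, ∃ C : ℝ, Continuous f ∧ (∀ x, |f x| ≤ C) ∧
      EqOn (derivWithin (derivWithin u (Icc 0 T)) (Icc 0 T)) f (Icc 0 T) := by
  have hcont : ContinuousOn (derivWithin (derivWithin u (Icc 0 T)) (Icc 0 T)) (Icc 0 T) :=
    (hu.derivWithin (m := 1) (uniqueDiffOn_Icc hT) (by norm_num)).continuousOn_derivWithin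
      (uniqueDiffOn_Icc hT) le_rfl
  obtain ⟨C, hC⟩ := isCompact_Icc.exists_bound_of_continuousOn hcont
  refine ⟨IccExtend hT.le
    ((Icc 0 T).domRestrict (derivWithin (derivWithin u (Icc 0 T)) (Icc 0 T))), C, hcont.domRestrict.Icc_extend', fun x => ?_,
    fun x hx => ?_⟩
  · exact hC _ (projIcc 0 T hT.le x).2
  · rw [IccExtend_of_mem hT.le _ hx, domRestrict_apply]

lemma ProbabilityTheory.beta_comm (a b : ℝ) : beta a b = beta b a := by
  rw [beta, beta, mul_comm, add_comm]

lemma sub_eq_integral_of_derivWithin_eqOn {T : ℝ}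
    {v f : ℝ → ℝ} (hv : DifferentiableOn ℝ v (Icc 0 T)) (hf : Continuous f)
    (hvf : EqOn (derivWithin v (Icc 0 T)) f (Icc 0 T)) {x : ℝ} (hx : x ∈ Icc 0 T) :
    v x - v 0 = ∫ s in (0 : ℝ)..x, f s := by
  refine (intervalIntegral.integral_eq_sub_of_hasDerivAt_of_le hx.1
    (hv.continuousOn.mono (Icc_subset_Icc_right hx.2)) (fun y hy => ?_)
    (hf.intervalIntegrable 0 x)).symm
  have hy' : y ∈ Ioo 0 T := ⟨hy.1, hy.2.trans_le hx.2⟩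
  rw [← hvf (Ioo_subset_Icc_self hy')]
  exact (hv y (Ioo_subset_Icc_self hy')).hasDerivWithinAt.hasDerivAt (Icc_mem_nhds hy'.1 hy'.2)

lemma caputoLow_eq_rlIntegral (T β : ℝ) (g : ℝ → ℝ) (t : ℝ) :
    caputoLow T β g t =
      (Real.Gamma (1 - β))⁻¹ * rlIntegral (1 - β) (derivWithin g (Icc 0 T)) t := by
  rw [caputoLow, rlIntegral, show 1 - β - 1 = -β by ring]

lemma caputoHigh_eq_rlIntegral (T α : ℝ) (v : ℝ → ℝ) (t : ℝ) :
    caputoHigh T α v t =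
      (Real.Gamma (2 - α))⁻¹ *
        rlIntegral (2 - α) (derivWithin (derivWithin v (Icc 0 T)) (Icc 0 T)) t := by
  rw [caputoHigh, rlIntegral, show 2 - α - 1 = 1 - α by ring]

/-- If `v'(0) = 0`, then the derivative of `D^β v` is the Riemann–Liouville integral of `v''`. -/
lemma derivWithin_caputoLow {T β C : ℝ} (hT : 0 < T) (hβ : β < 1) {v f : ℝ → ℝ}
    (hf : Continuous f) (hC : ∀ x, |f x| ≤ C)
    (hv : EqOn (derivWithin v (Icc 0 T)) (fun x => ∫ s in (0 : ℝ)..x, f s) (Icc 0 T)) :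
    EqOn (derivWithin (caputoLow T β v) (Icc 0 T))
      (fun x => (Real.Gamma (1 - β))⁻¹ * rlIntegral (1 - β) f x) (Icc 0 T) := by
  have hγ : 0 < 1 - β := by linarith
  obtain ⟨g, hg, hgeq⟩ := exists_continuous_eqOn_rlIntegral hγ hf hC
  have hlow : EqOn (caputoLow T β v)
      (fun x => (Real.Gamma (1 - β))⁻¹ * ∫ s in (0 : ℝ)..x, g s) (Icc 0 T) := fun x hx => by
    have h1 := rlIntegral_rlIntegral hγ one_pos hf hC hx.1
    have h2 := rlIntegral_rlIntegral one_pos hγ hf hC hx.1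
    rw [ProbabilityTheory.beta_comm, add_comm, ← h1] at h2
    beta_reduce
    rw [caputoLow_eq_rlIntegral, ← rlIntegral_one g,
      ← rlIntegral_congr hx.1 fun s hs => hgeq (mem_Ici.2 hs.1.le), h2]
    congr 1
    refine rlIntegral_congr hx.1 fun s hs => ?_
    rw [hv ⟨hs.1.le, hs.2.trans hx.2⟩, rlIntegral_one]
  intro x hx
  beta_reduce
  rw [derivWithin_congr hlow (hlow hx), hgeq (mem_Ici.2 hx.1)]
  exact ((hg.integral_hasStrictDerivAt 0 x).hasDerivAt.const_mul _).hasDerivWithinAt.derivWithin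
    (uniqueDiffOn_Icc hT x hx)


/-- Lemma 4.1 of the paper, SFOR identity.
For `α ∈ (1,2)`, `β = α/2`, `u ∈ C²([0,T])` and `ũ(t) := u(t) − t u'(0)`, for every
`t ∈ (0,T]`: `D^α u(t) = D^α ũ(t) = D^β(D^β ũ)(t)`. -/
theorem stmt7 (T α : ℝ) (hT : 0 < T) (hα1 : 1 < α) (hα2 : α < 2)
    (u : ℝ → ℝ) (hu : ContDiffOn ℝ 2 u (Set.Icc (0 : ℝ) T)) :
    ∀ t ∈ Set.Ioc (0 : ℝ) T,
      caputoHigh T α u t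
          = caputoHigh T α (fun s => u s - s * derivWithin u (Set.Icc (0 : ℝ) T) 0) t ∧
      caputoHigh T α u t
          = caputoLow T (α / 2)
              (caputoLow T (α / 2)
                (fun s => u s - s * derivWithin u (Set.Icc (0 : ℝ) T) 0)) t := by
  intro t ht
  set c := derivWithin u (Icc 0 T) 0
  have hU := uniqueDiffOn_Icc hT
  obtain ⟨f, C, hf, hC, huf⟩ := hu.exists_continuous_bounded_eqOn_derivWithin hT
  have hv1 : EqOn (derivWithin (fun s => u s - s * c) (Icc 0 T))
      (fun s => derivWithin u (Icc 0 T) s - c) (Icc 0 T) := fun s hs => by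
    have h := ((hu.differentiableOn (by norm_num) s hs).hasDerivWithinAt.sub
      ((hasDerivWithinAt_id s _).mul_const c)).derivWithin (hU s hs)
    rw [one_mul] at h
    exact h
  have hv2 : EqOn (derivWithin (derivWithin (fun s => u s - s * c) (Icc 0 T)) (Icc 0 T))
      (derivWithin (derivWithin u (Icc 0 T)) (Icc 0 T)) (Icc 0 T) := fun s hs => by
    rw [derivWithin_congr hv1 (hv1 hs), derivWithin_sub_const]
  have hint : EqOn (derivWithin (fun s => u s - s * c) (Icc 0 T))
      (fun x => ∫ s in (0 : ℝ)..x, f s) (Icc 0 T) := fun x hx => by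
    rw [hv1 hx]
    exact sub_eq_integral_of_derivWithin_eqOn
      ((hu.derivWithin (m := 1) hU (by norm_num)).differentiableOn (by norm_num)) hf huf hx
  have hmem : ∀ s ∈ Ioc 0 t, s ∈ Icc 0 T := fun s hs => ⟨hs.1.le, hs.2.trans ht.2⟩
  refine ⟨?_, ?_⟩
  · rw [caputoHigh_eq_rlIntegral, caputoHigh_eq_rlIntegral]
    congr 1
    exact rlIntegral_congr ht.1.le fun s hs => (hv2 (hmem s hs)).symm
  · have hγ : 0 < 1 - α / 2 := by linarith
    rw [caputoHigh_eq_rlIntegral, caputoLow_eq_rlIntegral,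
      rlIntegral_congr ht.1.le fun s hs => huf (hmem s hs),
      rlIntegral_congr ht.1.le fun s hs =>
        derivWithin_caputoLow hT (by linarith) hf hC hint (hmem s hs),
      rlIntegral_const_mul, rlIntegral_rlIntegral hγ hγ hf hC ht.1.le, ProbabilityTheory.beta,
      show 1 - α / 2 + (1 - α / 2) = 2 - α by ring]
    have hΓ := (Real.Gamma_pos_of_pos hγ).ne'
    generalize Real.Gamma (1 - α / 2) = G at hΓ ⊢
    field_simp
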